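/- Let V = ℝ⁷ with standard basis, let e¹, …, e⁷ be the dual basis of V* = (ℝ⁷)*, and let φ = e¹∧e²∧e³ − e¹∧e⁴∧e⁵ − e¹∧e⁶∧e⁷ − e²∧e⁴∧e⁶ + e²∧e⁵∧e⁷ − e³∧e⁴∧e⁷ − e³∧e⁵∧e⁶ be the standard G₂ three-form, regarded as a degree-3 element of the exterior algebra Λ(V*). For X ∈ V let ι_X denote left contraction of elements of Λ(V*) with the evaluation functional of X (an element of the dual of V*). Then for every nonzero ξ ∈ V* and every nonzero X ∈ V, the element ξ ∧ (ι_X φ) of Λ(V*) is nonzero; equivalently, for each nonzero ξ ∈ V* the linear map V → Λ³(V*), X ↦ ξ ∧ ι_X φ, is injective. -/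

import Mathlib

/-- The coordinate functionals `e¹, …, e⁷` on `ℝ⁷`, i.e. the dual basis of the standard
basis of `ℝ⁷`. -/
noncomputable def stdDual (i : Fin 7) : Module.Dual ℝ (Fin 7 → ℝ) :=
  LinearMap.proj i

/-- The basic wedge monomial `eⁱ ∧ eʲ ∧ eᵏ` in the exterior algebra `Λ((ℝ⁷)*)`. -/
noncomputable def wedge3 (i j k : Fin 7) :
    ExteriorAlgebra ℝ (Module.Dual ℝ (Fin 7 → ℝ)) :=
  ExteriorAlgebra.ι ℝ (stdDual i) * ExteriorAlgebra.ι ℝ (stdDual j) *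
    ExteriorAlgebra.ι ℝ (stdDual k)

/-- The standard `G₂` three-form
`φ = e¹∧e²∧e³ − e¹∧e⁴∧e⁵ − e¹∧e⁶∧e⁷ − e²∧e⁴∧e⁶ + e²∧e⁵∧e⁷ − e³∧e⁴∧e⁷ − e³∧e⁵∧e⁶`
(indices `1, …, 7` rendered as `0, …, 6`), as a degree-3 element of `Λ((ℝ⁷)*)`. -/
noncomputable def g2StdForm : ExteriorAlgebra ℝ (Module.Dual ℝ (Fin 7 → ℝ)) :=
  wedge3 0 1 2 - wedge3 0 3 4 - wedge3 0 5 6 - wedge3 1 3 5 + wedge3 1 4 6 -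
    wedge3 2 3 6 - wedge3 2 4 5

namespace ExteriorAlgebra

variable {R M : Type*} [CommRing R] [AddCommGroup M] [Module R M]

lemma contractLeft_ι_mul (d : Module.Dual R M) (m : M) (b : ExteriorAlgebra R M) :
    CliffordAlgebra.contractLeft d (ι R m * b) =
      d m • b - ι R m * CliffordAlgebra.contractLeft d b :=
  CliffordAlgebra.contractLeft_ι_mul d m b

lemma contractLeft_ι (d : Module.Dual R M) (m : M) :
    CliffordAlgebra.contractLeft d (ι R m) = algebraMap R (ExteriorAlgebra R M) (d m) :=
  CliffordAlgebra.contractLeft_ι _ d m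

lemma contractLeft_algebraMap (d : Module.Dual R M) (r : R) :
    CliffordAlgebra.contractLeft d (algebraMap R (ExteriorAlgebra R M) r) = 0 :=
  CliffordAlgebra.contractLeft_algebraMap _ d r

open CliffordAlgebra (contractLeft)

lemma contractLeft_contractLeft_ι_mul_ι (m m' : M) (d d' : Module.Dual R M) :
    contractLeft d' (contractLeft d (ι R m * ι R m')) =
      algebraMap R (ExteriorAlgebra R M) (d m * d' m' - d' m * d m') := by
  simp only [contractLeft_ι_mul, contractLeft_ι, contractLeft_algebraMap, map_sub, map_smul,
    mul_zero, sub_zero, map_mul]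
  simp only [Algebra.smul_def]

/-- The value of a triple contraction of `m ∧ ω` when the double contractions of `ω` are
the scalars given by `w`. -/
lemma contractLeft_contractLeft_contractLeft_ι_mul (m : M) (ω : ExteriorAlgebra R M)
    (w : Module.Dual R M → Module.Dual R M → R)
    (hw : ∀ d d', contractLeft d' (contractLeft d ω) = algebraMap R (ExteriorAlgebra R M) (w d d'))
    (d d' d'' : Module.Dual R M) :
    contractLeft d'' (contractLeft d' (contractLeft d (ι R m * ω))) =
      algebraMap R (ExteriorAlgebra R M) (d m * w d' d'' - d' m * w d d'' + d'' m * w d d') := by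
  simp only [contractLeft_ι_mul, contractLeft_algebraMap, map_sub, map_smul, hw, mul_zero,
    sub_zero, map_add, map_mul]
  simp only [Algebra.smul_def]
  abel

end ExteriorAlgebra

/-- The scalar obtained by contracting `eⁱ ∧ eʲ ∧ eᵏ` with three functionals. -/
noncomputable def wedge3Coeff (i j k : Fin 7)
    (d d' d'' : Module.Dual ℝ (Module.Dual ℝ (Fin 7 → ℝ))) : ℝ :=
  d (stdDual i) * (d' (stdDual j) * d'' (stdDual k) - d' (stdDual k) * d'' (stdDual j)) -
    d (stdDual j) * (d' (stdDual i) * d'' (stdDual k) - d' (stdDual k) * d'' (stdDual i)) +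
    d (stdDual k) * (d' (stdDual i) * d'' (stdDual j) - d' (stdDual j) * d'' (stdDual i))

open CliffordAlgebra (contractLeft) in
lemma contractLeft_contractLeft_contractLeft_wedge3 (i j k : Fin 7)
    (d d' d'' : Module.Dual ℝ (Module.Dual ℝ (Fin 7 → ℝ))) :
    contractLeft d'' (contractLeft d' (contractLeft d (wedge3 i j k))) =
      algebraMap ℝ (ExteriorAlgebra ℝ (Module.Dual ℝ (Fin 7 → ℝ)))
        (wedge3Coeff i j k d d' d'') := by
  rw [wedge3, mul_assoc, ExteriorAlgebra.contractLeft_contractLeft_contractLeft_ι_mul (stdDual i)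
    _ (fun d d' => d (stdDual j) * d' (stdDual k) - d' (stdDual j) * d (stdDual k))]
  · congr 1
    simp only [wedge3Coeff]
    ring
  · exact ExteriorAlgebra.contractLeft_contractLeft_ι_mul_ι _ _

/-- The scalar obtained by contracting the standard `G₂` three-form with three functionals. -/
noncomputable def g2Coeff (d d' d'' : Module.Dual ℝ (Module.Dual ℝ (Fin 7 → ℝ))) : ℝ :=
  wedge3Coeff 0 1 2 d d' d'' - wedge3Coeff 0 3 4 d d' d'' - wedge3Coeff 0 5 6 d d' d'' -
    wedge3Coeff 1 3 5 d d' d'' + wedge3Coeff 1 4 6 d d' d'' - wedge3Coeff 2 3 6 d d' d'' -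
    wedge3Coeff 2 4 5 d d' d''

open CliffordAlgebra (contractLeft) in
lemma contractLeft_contractLeft_contractLeft_g2StdForm
    (d d' d'' : Module.Dual ℝ (Module.Dual ℝ (Fin 7 → ℝ))) :
    contractLeft d'' (contractLeft d' (contractLeft d g2StdForm)) =
      algebraMap ℝ (ExteriorAlgebra ℝ (Module.Dual ℝ (Fin 7 → ℝ))) (g2Coeff d d' d'') := by
  simp only [g2StdForm, g2Coeff, map_sub, map_add, contractLeft_contractLeft_contractLeft_wedge3]

/-- If the 3-form `a ∧ w` vanishes, then `|a|² |w|² = 2 |ι_a w|²`, where `|w|²` sums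
over all ordered pairs of indices. -/
lemma sum_sq_mul_sum_sq_eq_of_wedge_eq_zero {ι R : Type*} [Fintype ι] [CommRing R]
    (a : ι → R) (w : ι → ι → R) (hw : ∀ i j, w i j = -w j i)
    (h : ∀ i j k, a i * w j k - a j * w i k + a k * w i j = 0) :
    (∑ i, a i ^ 2) * ∑ j, ∑ k, w j k ^ 2 = 2 * ∑ k, (∑ i, a i * w i k) ^ 2 := by
  have h1 : ∀ j k, (∑ i, a i ^ 2) * w j k =
      a j * (∑ i, a i * w i k) - a k * ∑ i, a i * w i j := by
    intro j k
    simp only [Finset.sum_mul, Finset.mul_sum, ← Finset.sum_sub_distrib]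
    exact Finset.sum_congr rfl fun i _ => by linear_combination a i * h i j k
  have h2 : ∀ k, ∑ j, a j * (∑ i, a i * w i k) * w j k = (∑ i, a i * w i k) ^ 2 := by
    intro k
    rw [sq, Finset.sum_mul]
    exact Finset.sum_congr rfl fun j _ => by ring
  calc (∑ i, a i ^ 2) * ∑ j, ∑ k, w j k ^ 2
      = ∑ j, ∑ k, (a j * (∑ i, a i * w i k) * w j k + a k * (∑ i, a i * w i j) * w k j) := by
        simp only [Finset.mul_sum (s := Finset.univ) (a := ∑ i, a i ^ 2)]
        refine Finset.sum_congr rfl fun j _ => Finset.sum_congr rfl fun k _ => ?_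
        rw [hw k j]
        linear_combination w j k * h1 j k
    _ = 2 * ∑ k, (∑ i, a i * w i k) ^ 2 := by
        simp only [Finset.sum_add_distrib, h2]
        rw [Finset.sum_comm]
        simp only [h2]
        ring

/-- For every nonzero `ξ ∈ (ℝ⁷)*` and every nonzero `X ∈ ℝ⁷`, the
element `ξ ∧ (ι_X φ)` of `Λ((ℝ⁷)*)` is nonzero, where `φ` is the standard `G₂`
three-form and `ι_X` is left contraction with the evaluation functional of `X`.
Equivalently, for each nonzero `ξ` the linear map `X ↦ ξ ∧ ι_X φ` is injective: the
principal symbol of the infinitesimal pullback action on `G₂`-structures is injective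
away from the zero section. -/
theorem g2_symbol_injective :
    ∀ ξ : Module.Dual ℝ (Fin 7 → ℝ), ξ ≠ 0 → ∀ X : Fin 7 → ℝ, X ≠ 0 →
      ExteriorAlgebra.ι ℝ ξ *
        CliffordAlgebra.contractLeft (Module.Dual.eval ℝ (Fin 7 → ℝ) X) g2StdForm ≠ 0 := by
  intro ξ hξ X hX h
  set a : Fin 7 → ℝ := fun i => ξ (Pi.single i 1) with ha
  set E : Fin 7 → Module.Dual ℝ (Module.Dual ℝ (Fin 7 → ℝ)) :=
    fun i => Module.Dual.eval ℝ (Fin 7 → ℝ) (Pi.single i 1) with hE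
  set w : Fin 7 → Fin 7 → ℝ :=
    fun i j => g2Coeff (Module.Dual.eval ℝ (Fin 7 → ℝ) X) (E i) (E j) with hw
  have hT : ∀ i j k, a i * w j k - a j * w i k + a k * w i j = 0 := by
    intro i j k
    have := ExteriorAlgebra.contractLeft_contractLeft_contractLeft_ι_mul ξ _ _
      (contractLeft_contractLeft_contractLeft_g2StdForm (Module.Dual.eval ℝ (Fin 7 → ℝ) X))
      (E i) (E j) (E k)
    rw [h, map_zero, map_zero, map_zero, eq_comm, ExteriorAlgebra.algebraMap_eq_zero_iff] at this
    exact this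
  have hanti : ∀ i j, w i j = -w j i := by
    intro i j
    simp only [hw, g2Coeff, wedge3Coeff]
    ring
  have key := sum_sq_mul_sum_sq_eq_of_wedge_eq_zero a w hanti hT
  have hEc : ∀ i j, E i (stdDual j) = if j = i then 1 else 0 := by
    intro i j
    simp [hE, stdDual, Pi.single_apply]
  have hXc : ∀ j, Module.Dual.eval ℝ (Fin 7 → ℝ) X (stdDual j) = X j := fun j => rfl
  have hw2 : ∑ j, ∑ k, w j k ^ 2 = 6 * ∑ i, X i ^ 2 := by
    simp [hw, g2Coeff, wedge3Coeff, hEc, hXc, Fin.sum_univ_seven]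
    ring
  have hcross : ∑ k, (∑ i, a i * w i k) ^ 2 =
      (∑ i, a i ^ 2) * (∑ i, X i ^ 2) - (∑ i, a i * X i) ^ 2 := by
    simp only [hw, g2Coeff, wedge3Coeff, hEc, hXc]
    clear_value a
    simp [Fin.sum_univ_seven]
    ring
  obtain ⟨p, hp⟩ := Function.ne_iff.mp hX
  have hXpos : 0 < ∑ i, X i ^ 2 :=
    Finset.sum_pos' (fun i _ => sq_nonneg _) ⟨p, Finset.mem_univ _, sq_pos_of_ne_zero hp⟩
  have ha0 : a ≠ 0 := fun h0 => hξ <| LinearMap.pi_ext' fun i => LinearMap.ext_ring (congrFun h0 i)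
  obtain ⟨q, hq⟩ := Function.ne_iff.mp ha0
  have hapos : 0 < ∑ i, a i ^ 2 :=
    Finset.sum_pos' (fun i _ => sq_nonneg _) ⟨q, Finset.mem_univ _, sq_pos_of_ne_zero hq⟩
  rw [hw2, hcross] at key
  nlinarith [mul_pos hapos hXpos, sq_nonneg (∑ i, a i * X i)]
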